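/- Let {y^k} ⊆ ℝ^m be a sequence and Y ⊆ ℝ^m a nonempty set. Assume that each accumulation point of {y^k} belongs to Y and that, for each y ∈ Y, the sequence of real numbers {‖y^k - y‖} converges. Then there exists ȳ ∈ Y such that y^k → ȳ. -/

import Mathlib

/-- If every accumulation point of a sequence `y` in `ℝ^m` belongs to a nonempty set `Y`,
and for every `v ∈ Y` the real sequence `‖y k - v‖` converges, then `y` converges to
some point of `Y`. -/
theorem converges_of_accumulation_points_and_fejer {m : ℕ}
    (y : ℕ → EuclideanSpace ℝ (Fin m)) (Y : Set (EuclideanSpace ℝ (Fin m)))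
    (hY : Y.Nonempty)
    (hacc : ∀ a : EuclideanSpace ℝ (Fin m),
      (∃ ψ : ℕ → ℕ, StrictMono ψ ∧ Filter.Tendsto (y ∘ ψ) Filter.atTop (nhds a)) → a ∈ Y)
    (hconv : ∀ v ∈ Y, ∃ L : ℝ, Filter.Tendsto (fun k => ‖y k - v‖) Filter.atTop (nhds L)) :
    ∃ ybar ∈ Y, Filter.Tendsto y Filter.atTop (nhds ybar) := by
  obtain ⟨v, hv⟩ := hY
  obtain ⟨L, hL⟩ := hconv v hv
  obtain ⟨R, hR⟩ := hL.bddAbove_range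
  have hball : ∀ n, y n ∈ Metric.closedBall v R := by
    intro n
    rw [mem_closedBall_iff_norm]
    exact hR ⟨n, rfl⟩
  obtain ⟨a, -, ψ, hψ, ha⟩ := (isCompact_closedBall v R).tendsto_subseq hball
  have haY : a ∈ Y := hacc a ⟨ψ, hψ, ha⟩
  refine ⟨a, haY, ?_⟩
  obtain ⟨M, hM⟩ := hconv a haY
  have h1 : Filter.Tendsto (fun k => ‖y (ψ k) - a‖) Filter.atTop (nhds M) :=
    hM.comp hψ.tendsto_atTop
  have h2 : Filter.Tendsto (fun k => ‖y (ψ k) - a‖) Filter.atTop (nhds 0) :=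
    tendsto_iff_norm_sub_tendsto_zero.mp ha
  have hM0 : M = 0 := tendsto_nhds_unique h1 h2
  rw [hM0] at hM
  exact tendsto_iff_norm_sub_tendsto_zero.mpr hM
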